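/- arXiv:1504.07449 — 3 statements merged into one kernel-verified Lean document; each statement's English description precedes it below -/
import Mathlib

section
/- Let Γ be a finite simplicial graph. Then Γ satisfies property (B) (i.e. both (B1) and (B2)) if and only if A_Γ is isomorphic to a direct product F_{n₁} × … × F_{n_k} × ℤ^a of finitely many free groups F_{nᵢ} of ranks nᵢ ≥ 3 and a free abelian group ℤ^a with a ≠ 2; moreover, in that case the numbers n₁, …, n_k and a are the cardinalities of the equivalence classes of vertices under ∼. -/
open SimpleGraph

namespace RaagPaper

variable {V : Type} [Fintype V] [DecidableEq V]

/-- The defining relations of the right-angled Artin group of a graph `Γ`. -/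
def Rels (Γ : SimpleGraph V) : Set (FreeGroup V) :=
  {r | ∃ u v : V, Γ.Adj u v ∧
    r = FreeGroup.of u * FreeGroup.of v * (FreeGroup.of u)⁻¹ * (FreeGroup.of v)⁻¹}

/-- The right-angled Artin group of `Γ`. -/
abbrev Raag (Γ : SimpleGraph V) := PresentedGroup (Rels Γ)

/-- The generator of `Raag Γ` corresponding to the vertex `v`. -/
def gen (Γ : SimpleGraph V) (v : V) : Raag Γ := PresentedGroup.of v

/-- The link of a vertex. -/
def lk (Γ : SimpleGraph V) (v : V) : Set V := Γ.neighborSet v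

/-- The star of a vertex. -/
def st (Γ : SimpleGraph V) (v : V) : Set V := insert v (Γ.neighborSet v)

/-- The partial preorder `v ≤ w ↔ lk v ⊆ st w` on vertices. -/
def Le (Γ : SimpleGraph V) (v w : V) : Prop := lk Γ v ⊆ st Γ w

/-- The equivalence `v ∼ w`. -/
def Sim (Γ : SimpleGraph V) (v w : V) : Prop := Le Γ v w ∧ Le Γ w v

/-- The equivalence class of a vertex under `∼`. -/
def simClass (Γ : SimpleGraph V) (v : V) : Set V := {u | Sim Γ u v}

/-- Property (B1): any two distinct non-adjacent vertices are `∼`-equivalent. -/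
def B1 (Γ : SimpleGraph V) : Prop :=
  ∀ u v : V, u ≠ v → ¬ Γ.Adj u v → Sim Γ u v

/-- Property (B2). -/
def B2 (Γ : SimpleGraph V) : Prop :=
  ∀ v w : V, v ≠ w → Le Γ v w → ∃ u : V, u ≠ v ∧ u ≠ w ∧ Le Γ v u ∧ Le Γ u w

/-- `α` is the transvection `t_{vw}` for some `v ≤ w`. -/
def IsTransvection (Γ : SimpleGraph V) (α : MulAut (Raag Γ)) : Prop :=
  ∃ v w : V, v ≠ w ∧ Le Γ v w ∧ α (gen Γ v) = gen Γ v * gen Γ w ∧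
    ∀ z : V, z ≠ v → α (gen Γ z) = gen Γ z

/-- `Y` is (the vertex set of) a connected component of the subgraph of `Γ` induced on `S`. -/
def IsCompOf (Γ : SimpleGraph V) (S : Set V) (Y : Set V) : Prop :=
  ∃ C : (Γ.induce S).ConnectedComponent, Y = Subtype.val '' C.supp

/-- `α` is a partial conjugation `c_{v,Y}`. -/
def IsPartialConj (Γ : SimpleGraph V) (α : MulAut (Raag Γ)) : Prop :=
  ∃ (v : V) (Y : Set V), IsCompOf Γ (st Γ v)ᶜ Y ∧
    (∀ y ∈ Y, α (gen Γ y) = (gen Γ v)⁻¹ * gen Γ y * gen Γ v) ∧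
    (∀ z : V, z ∉ Y → α (gen Γ z) = gen Γ z)

/-- `α` is the inversion `ι_v`. -/
def IsInversion (Γ : SimpleGraph V) (α : MulAut (Raag Γ)) : Prop :=
  ∃ v : V, α (gen Γ v) = (gen Γ v)⁻¹ ∧ ∀ z : V, z ≠ v → α (gen Γ z) = gen Γ z

/-- `SAut⁰(A_Γ)`: the subgroup generated by transvections and partial conjugations. -/
def SAut0 (Γ : SimpleGraph V) : Subgroup (MulAut (Raag Γ)) :=
  Subgroup.closure {α | IsTransvection Γ α ∨ IsPartialConj Γ α}

/-- `Aut⁰(A_Γ)`: the subgroup generated by transvections, partial conjugations and inversions. -/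
def Aut0 (Γ : SimpleGraph V) : Subgroup (MulAut (Raag Γ)) :=
  Subgroup.closure {α | IsTransvection Γ α ∨ IsPartialConj Γ α ∨ IsInversion Γ α}

/-- The natural map `Aut(A_Γ) → Aut(A_Γ^{ab})`. -/
def abAutHom (Γ : SimpleGraph V) :
    MulAut (Raag Γ) →* MulAut (Abelianization (Raag Γ)) :=
  MonoidHom.mk' (fun e => MulEquiv.abelianizationCongr e) (by
    intro e f
    exact (abelianizationCongr_trans f e).symm)

/-- The Torelli subgroup `IA_Γ`. -/
def IA (Γ : SimpleGraph V) : Subgroup (MulAut (Raag Γ)) := (abAutHom Γ).ker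

/-- The subgroup of `m`-th powers of `A_Γ^{ab}`; the quotient by it is `A_Γ^{ab} ⊗ ℤ/mℤ`. -/
def powN (Γ : SimpleGraph V) (m : ℕ) : Subgroup (Abelianization (Raag Γ)) :=
  (powMonoidHom m : Abelianization (Raag Γ) →* Abelianization (Raag Γ)).range

/-- `IA_Γ(m)`: the kernel of `Aut(A_Γ) → Aut(A_Γ^{ab} ⊗ ℤ/mℤ)`, i.e. the automorphisms
acting trivially on the abelianization modulo `m`-th powers. -/
def IAm (Γ : SimpleGraph V) (m : ℕ) : Subgroup (MulAut (Raag Γ)) where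
  carrier := {α | ∀ x : Abelianization (Raag Γ), abAutHom Γ α x * x⁻¹ ∈ powN Γ m}
  one_mem' := by
    intro x
    simp only [map_one, MulAut.one_apply, mul_inv_cancel]
    exact one_mem _
  mul_mem' := by
    intro a b ha hb x
    have h : abAutHom Γ (a * b) x * x⁻¹ =
        (abAutHom Γ a (abAutHom Γ b x) * (abAutHom Γ b x)⁻¹) * (abAutHom Γ b x * x⁻¹) := by
      simp only [map_mul, MulAut.mul_apply]
      group
    rw [h]
    exact mul_mem (ha _) (hb x)
  inv_mem' := by
    intro a ha x
    have h : abAutHom Γ a (abAutHom Γ a⁻¹ x) = x := by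
      have : abAutHom Γ a * abAutHom Γ a⁻¹ = 1 := by
        rw [← map_mul, mul_inv_cancel, map_one]
      calc abAutHom Γ a (abAutHom Γ a⁻¹ x) = (abAutHom Γ a * abAutHom Γ a⁻¹) x := rfl
        _ = x := by rw [this]; rfl
    have := inv_mem (ha (abAutHom Γ a⁻¹ x))
    rw [h] at this
    simpa [mul_comm] using this
  
/-- `SIA_Γ(m) = SAut⁰(A_Γ) ∩ IA_Γ(m)`. -/
def SIA (Γ : SimpleGraph V) (m : ℕ) : Subgroup (MulAut (Raag Γ)) := SAut0 Γ ⊓ IAm Γ m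

/-- The group of inner automorphisms of `A_Γ`. -/
def innSub (Γ : SimpleGraph V) : Subgroup (MulAut (Raag Γ)) :=
  (MulAut.conj : Raag Γ →* MulAut (Raag Γ)).range


/-- Property (NL): three pairwise distinct, pairwise non-adjacent vertices with
`v₃ ≤ v₁` and `v₃ ≤ v₂`. -/
def NL (Γ : SimpleGraph V) : Prop :=
  ∃ v₁ v₂ v₃ : V, v₁ ≠ v₂ ∧ v₁ ≠ v₃ ∧ v₂ ≠ v₃ ∧
    ¬ Γ.Adj v₁ v₂ ∧ ¬ Γ.Adj v₁ v₃ ∧ ¬ Γ.Adj v₂ v₃ ∧ Le Γ v₃ v₁ ∧ Le Γ v₃ v₂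

open Classical in
/-- The multiset of cardinalities of the equivalence classes of vertices under `∼`. -/
noncomputable def classSizes (Γ : SimpleGraph V) : Multiset ℕ :=
  (Finset.image (fun v => Set.toFinset (simClass Γ v)) Finset.univ).val.map Finset.card

section RaagHom

variable {V W G : Type} [Group G] {Γ : SimpleGraph V} {Λ : SimpleGraph W}

/-- The homomorphism out of `Raag Γ` given by images of the vertices which commute along edges. -/
def raagLift (f : V → G) (hf : ∀ u v, Γ.Adj u v → Commute (f u) (f v)) : Raag Γ →* G :=
  PresentedGroup.toGroup (f := f) (by
    rintro r ⟨u, v, huv, rfl⟩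
    simp [(hf u v huv).eq])

@[simp]
theorem raagLift_gen (f : V → G) (hf : ∀ u v, Γ.Adj u v → Commute (f u) (f v)) (v : V) :
    raagLift f hf (gen Γ v) = f v :=
  PresentedGroup.toGroup.of _

theorem raagHom_ext {φ ψ : Raag Γ →* G} (h : ∀ v, φ (gen Γ v) = ψ (gen Γ v)) : φ = ψ :=
  PresentedGroup.ext h

theorem commute_gen {u v : V} (h : Γ.Adj u v) : Commute (gen Γ u) (gen Γ v) := by
  have := PresentedGroup.one_of_mem (rels := Rels Γ) ⟨u, v, h, rfl⟩
  simp only [map_mul, map_inv] at this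
  rw [mul_inv_eq_one, mul_inv_eq_iff_eq_mul] at this
  exact this

/-- Isomorphic graphs have isomorphic right-angled Artin groups. -/
def raagCongr (e : Γ ≃g Λ) : Raag Γ ≃* Raag Λ :=
  MonoidHom.toMulEquiv
    (raagLift (fun v => gen Λ (e v)) fun _ _ h => commute_gen (e.map_rel_iff.2 h))
    (raagLift (fun v => gen Γ (e.symm v)) fun _ _ h => commute_gen (e.symm.map_rel_iff.2 h))
    (raagHom_ext fun v => by simp)
    (raagHom_ext fun v => by simp)

end RaagHom

section CompleteMultipartite

variable {ι : Type} (β : ι → Type)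

/-- The inclusion of the free group on one part of a complete multipartite graph. -/
def partHom (i : ι) : FreeGroup (β i) →* Raag (completeMultipartiteGraph β) :=
  FreeGroup.lift fun x => gen _ ⟨i, x⟩

theorem pairwise_commute_partHom :
    Pairwise fun i j => ∀ x y, Commute (partHom β i x) (partHom β j y) := by
  intro i j h x y
  have key (a : β i) (b : β j) :
      Commute (partHom β i (FreeGroup.of a)) (partHom β j (FreeGroup.of b)) := by
    simp only [partHom, FreeGroup.lift_apply_of]
    exact commute_gen (by simpa using h)
  induction x using FreeGroup.induction_on with
  | C1 => simp
  | of a =>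
    induction y using FreeGroup.induction_on with
    | C1 => simp
    | of b => exact key a b
    | inv_of b hb => simpa using hb
    | mul y z hy hz => simpa using hy.mul_right hz
  | inv_of a ha => simpa using ha
  | mul x z hx hz => simpa using hx.mul_left hz

open Classical in
/-- The right-angled Artin group of a complete multipartite graph is the product of the free
groups on its parts. -/
noncomputable def raagCompleteMultipartite [Fintype ι] :
    Raag (completeMultipartiteGraph β) ≃* ∀ i, FreeGroup (β i) :=
  MonoidHom.toMulEquiv
    (raagLift (fun v => Pi.mulSingle v.1 (FreeGroup.of v.2)) fun u v h =>
      by exact Pi.mulSingle_commute (show u.1 ≠ v.1 from h) _ _)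
    (MonoidHom.noncommPiCoprod (partHom β) (pairwise_commute_partHom β))
    (raagHom_ext fun v => by
      rw [MonoidHom.comp_apply, raagLift_gen,
        MonoidHom.noncommPiCoprod_mulSingle (N := fun i => FreeGroup (β i))]
      simp [partHom])
    (MonoidHom.pi_ext fun i x => by
      rw [MonoidHom.comp_apply, MonoidHom.id_apply,
        MonoidHom.noncommPiCoprod_mulSingle (N := fun i => FreeGroup (β i))]
      induction x using FreeGroup.induction_on with
      | C1 => simp
      | of a => simp [partHom]
      | inv_of a ha => simpa [Pi.mulSingle_inv] using ha
      | mul x z hx hz => simp [Pi.mulSingle_mul, hx, hz])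

/-- The parts of the model graph: parts of sizes `n i`, and `a` singletons. -/
abbrev modelPart {k : ℕ} (n : Fin k → ℕ) (a : ℕ) : Fin k ⊕ Fin a → Type :=
  Sum.elim (fun i => Fin (n i)) fun _ => Unit

/-- The complete multipartite graph with parts of sizes `n i`, and `a` further singleton parts. -/
abbrev modelGraph {k : ℕ} (n : Fin k → ℕ) (a : ℕ) : SimpleGraph (Σ s, modelPart n a s) :=
  completeMultipartiteGraph (modelPart n a)

/-- The right-angled Artin group of the model graph is `F_{n₁} × … × F_{n_k} × ℤ^a`. -/
noncomputable def raagModelGraph {k : ℕ} (n : Fin k → ℕ) (a : ℕ) :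
    Raag (modelGraph n a) ≃*
      ((∀ i : Fin k, FreeGroup (Fin (n i))) × (Fin a → Multiplicative ℤ)) :=
  (raagCompleteMultipartite (modelPart n a)).trans <|
    MulEquiv.trans
      { Equiv.sumPiEquivProdPi fun s => FreeGroup (modelPart n a s) with
        map_mul' := fun _ _ => rfl } <|
    MulEquiv.prodCongr (MulEquiv.refl _)
      (MulEquiv.piCongrRight fun _ => (FreeGroup.mulEquivIntOfUnique : FreeGroup Unit ≃* _))

end CompleteMultipartite

section Combinatorics

variable {V : Type} {Γ : SimpleGraph V}

/-- The vertices adjacent to all other vertices. -/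
def univVerts (Γ : SimpleGraph V) : Set V := {u | ∀ v, v ≠ u → Γ.Adj u v}

/-- A complete multipartite graph without parts of size two and whose number of singleton parts
is not two. -/
structure IsBMultipartite (Γ : SimpleGraph V) : Prop where
  isCompleteMultipartite : Γ.IsCompleteMultipartite
  ncard_part_ne_two : ∀ u, {v | ¬ Γ.Adj u v}.ncard ≠ 2
  ncard_univVerts_ne_two : (univVerts Γ).ncard ≠ 2

theorem exists_mem_ne_ne {s : Set V} {x y : V} (hx : x ∈ s) (hy : y ∈ s) (hxy : x ≠ y)
    (hs : s.ncard ≠ 2) : ∃ z ∈ s, z ≠ x ∧ z ≠ y := by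
  by_contra! h
  refine hs ?_
  have : s = {x, y} := by
    ext z
    simp only [Set.mem_insert_iff, Set.mem_singleton_iff]
    constructor
    · intro hz
      by_cases hzx : z = x
      · exact Or.inl hzx
      · exact Or.inr (h z hz hzx)
    · rintro (rfl | rfl) <;> assumption
  rw [this, Set.ncard_pair hxy]

theorem le_iff {v w : V} : Le Γ v w ↔ ∀ x, Γ.Adj v x → x = w ∨ Γ.Adj w x := Iff.rfl

theorem le_of_mem_univVerts {v w : V} (hw : w ∈ univVerts Γ) : Le Γ v w := by
  rw [le_iff]
  intro x _
  by_cases h : x = w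
  · exact Or.inl h
  · exact Or.inr (hw x h)

theorem le_of_not_adj (hΓ : Γ.IsCompleteMultipartite) {v w : V} (h : ¬ Γ.Adj v w) :
    Le Γ v w := by
  rw [le_iff]
  intro x hx
  by_contra! hc
  exact hΓ.trans v w x h hc.2 hx

theorem mem_univVerts_of_le_of_adj (hΓ : Γ.IsCompleteMultipartite) {v w : V} (hle : Le Γ v w)
    (hadj : Γ.Adj v w) : w ∈ univVerts Γ := by
  intro z hzw
  by_contra hwz
  have hvz : Γ.Adj v z := by
    by_contra hvz
    exact hΓ.trans v z w hvz (fun h => hwz h.symm) hadj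
  exact (le_iff.1 hle z hvz).elim hzw hwz

theorem sim_iff (hΓ : Γ.IsCompleteMultipartite) {v w : V} :
    Sim Γ v w ↔ ¬ Γ.Adj v w ∨ v ∈ univVerts Γ ∧ w ∈ univVerts Γ := by
  constructor
  · rintro ⟨hvw, hwv⟩
    by_cases h : Γ.Adj v w
    · exact Or.inr ⟨mem_univVerts_of_le_of_adj hΓ hwv h.symm, mem_univVerts_of_le_of_adj hΓ hvw h⟩
    · exact Or.inl h
  · rintro (h | ⟨hv, hw⟩)
    · exact ⟨le_of_not_adj hΓ h, le_of_not_adj hΓ fun h' => h h'.symm⟩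
    · exact ⟨le_of_mem_univVerts hw, le_of_mem_univVerts hv⟩

theorem isBMultipartite_of_property (h₁ : B1 Γ) (h₂ : B2 Γ) : IsBMultipartite Γ := by
  have hT : Γ.IsCompleteMultipartite := by
    refine ⟨fun u v w huv hvw huw => ?_⟩
    have hne : u ≠ v := by rintro rfl; exact hvw huw
    rcases le_iff.1 (h₁ u v hne huv).1 w huw with rfl | h
    · exact huv huw
    · exact hvw h
  refine ⟨hT, fun u hu => ?_, fun hu => ?_⟩
  · obtain ⟨x, y, hxy, hs⟩ := Set.ncard_eq_two.1 hu
    have hux : ¬ Γ.Adj u x := by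
      have : x ∈ {v | ¬ Γ.Adj u v} := by simp [hs]
      exact this
    have huy : ¬ Γ.Adj u y := by
      have : y ∈ {v | ¬ Γ.Adj u v} := by simp [hs]
      exact this
    have hxy' : ¬ Γ.Adj x y := hT.trans x u y (fun h => hux h.symm) huy
    obtain ⟨z, hzx, hzy, -, hle⟩ := h₂ x y hxy (le_of_not_adj hT hxy')
    by_cases hz : Γ.Adj z x
    · rcases le_iff.1 hle x hz with h | h
      · exact hxy h
      · exact hxy' h.symm
    · have : z ∈ {v | ¬ Γ.Adj u v} := hT.trans u x z hux fun h => hz h.symm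
      rw [hs] at this
      simp_all
  · obtain ⟨x, y, hxy, hs⟩ := Set.ncard_eq_two.1 hu
    have hx : x ∈ univVerts Γ := by simp [hs]
    have hy : y ∈ univVerts Γ := by simp [hs]
    obtain ⟨z, hzx, hzy, hle, -⟩ := h₂ x y hxy (le_of_mem_univVerts hy)
    have hz : z ∈ univVerts Γ := by
      intro w hwz
      by_cases hwx : w = x
      · subst hwx; exact (hx z hzx).symm
      · exact (le_iff.1 hle w (hx w hwx)).resolve_left hwz
    rw [hs] at hz
    simp_all

theorem IsBMultipartite.property (h : IsBMultipartite Γ) : B1 Γ ∧ B2 Γ := by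
  have hT := h.isCompleteMultipartite
  refine ⟨fun u v _ huv =>
    ⟨le_of_not_adj hT huv, le_of_not_adj hT fun h => huv h.symm⟩, fun v w hvw hle => ?_⟩
  by_cases hadj : Γ.Adj v w
  · have hw : w ∈ univVerts Γ := mem_univVerts_of_le_of_adj hT hle hadj
    by_cases hv : v ∈ univVerts Γ
    · obtain ⟨z, hz, hzv, hzw⟩ := exists_mem_ne_ne hv hw hvw h.ncard_univVerts_ne_two
      exact ⟨z, hzv, hzw, le_of_mem_univVerts hz, le_of_mem_univVerts hw⟩
    · simp only [univVerts, Set.mem_ofPred_eq, not_forall] at hv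
      obtain ⟨z, hzv, hvz⟩ := hv
      refine ⟨z, hzv, ?_, le_of_not_adj hT hvz, le_of_mem_univVerts hw⟩
      rintro rfl
      exact hvz hadj
  · obtain ⟨z, hz, hzv, hzw⟩ := exists_mem_ne_ne (s := {x | ¬ Γ.Adj v x}) (x := v) (y := w)
      (by simp) hadj hvw (h.ncard_part_ne_two v)
    exact ⟨z, hzv, hzw, le_of_not_adj hT hz,
      le_of_not_adj hT (hT.trans z v w (fun h => hz h.symm) hadj)⟩

section Model

variable {k : ℕ} {n : Fin k → ℕ} {a : ℕ}

theorem ncard_modelPart (s : Fin k ⊕ Fin a) :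
    {v : Σ s, modelPart n a s | v.1 = s}.ncard = Nat.card (modelPart n a s) := by
  rw [← Nat.card_coe_set_eq]
  exact Nat.card_congr
    { toFun := fun v => cast (congrArg _ v.2) v.1.2
      invFun := fun x => ⟨⟨s, x⟩, rfl⟩
      left_inv := by rintro ⟨⟨t, x⟩, rfl⟩; rfl
      right_inv := fun x => rfl }

theorem univVerts_modelGraph (hn : ∀ i, 3 ≤ n i) :
    univVerts (modelGraph n a) = Set.range fun j : Fin a => ⟨Sum.inr j, ()⟩ := by
  ext ⟨s, x⟩
  simp only [univVerts, Set.mem_ofPred_eq, Set.mem_range]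
  constructor
  · intro h
    rcases s with i | j
    · have : Nontrivial (Fin (n i)) := Fin.nontrivial_iff_two_le.2 (by have := hn i; omega)
      obtain ⟨y, hy⟩ := exists_ne (α := Fin (n i)) x
      exact absurd rfl (h ⟨Sum.inl i, y⟩ fun h => hy (eq_of_heq (Sigma.mk.inj h).2))
    · exact ⟨j, rfl⟩
  · rintro ⟨j, hj⟩ ⟨t, y⟩ hne
    rw [← hj] at hne ⊢
    change Sum.inr j ≠ t
    rintro rfl
    exact hne rfl

theorem ncard_univVerts_modelGraph (hn : ∀ i, 3 ≤ n i) : (univVerts (modelGraph n a)).ncard = a := by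
  have hinj : Function.Injective fun j : Fin a => (⟨Sum.inr j, ()⟩ : Σ s, modelPart n a s) :=
    fun i j h => Sum.inr_injective (Sigma.mk.inj h).1
  rw [univVerts_modelGraph hn, ← Nat.card_coe_set_eq, Nat.card_range_of_injective hinj,
    Nat.card_fin]

theorem isBMultipartite_modelGraph (hn : ∀ i, 3 ≤ n i) (ha : a ≠ 2) :
    IsBMultipartite (modelGraph n a) := by
  refine ⟨completeMultipartiteGraph.isCompleteMultipartite _, ?_, ?_⟩
  · rintro ⟨s, x⟩
    have : {v | ¬ (modelGraph n a).Adj ⟨s, x⟩ v} = {v | v.1 = s} := by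
      ext v
      simp [eq_comm]
    rw [this, ncard_modelPart]
    rcases s with i | j
    · have := hn i
      simp only [modelPart, Sum.elim_inl, Nat.card_fin]
      omega
    · simp
  · rwa [ncard_univVerts_modelGraph hn]

theorem mem_univVerts_iff {W : Type} {Λ : SimpleGraph W} (e : Γ ≃g Λ) {v : V} :
    v ∈ univVerts Γ ↔ e v ∈ univVerts Λ := by
  constructor
  · intro h w hw
    obtain ⟨w, rfl⟩ := e.surjective w
    exact e.map_rel_iff.2 (h w fun h => hw (by rw [h]))
  · intro h w hw
    exact e.map_rel_iff.1 (h (e w) (e.injective.ne hw))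

theorem ncard_univVerts_congr {W : Type} {Λ : SimpleGraph W} (e : Γ ≃g Λ) :
    (univVerts Γ).ncard = (univVerts Λ).ncard := by
  rw [← Nat.card_coe_set_eq, ← Nat.card_coe_set_eq]
  exact Nat.card_congr (e.toEquiv.subtypeEquiv fun v => mem_univVerts_iff e)

end Model

end Combinatorics

section CupProduct

/-- The Heisenberg group over `ℤ/2`. -/
@[ext]
structure Heis where
  /-- The first coordinate of the abelianization. -/
  fst : ZMod 2
  /-- The second coordinate of the abelianization. -/
  snd : ZMod 2
  /-- The central coordinate. -/
  cen : ZMod 2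

instance : Group Heis where
  mul x y := ⟨x.fst + y.fst, x.snd + y.snd, x.cen + y.cen + x.fst * y.snd⟩
  one := ⟨0, 0, 0⟩
  inv x := ⟨-x.fst, -x.snd, -x.cen + x.fst * x.snd⟩
  mul_assoc x y z := Heis.ext (add_assoc _ _ _) (add_assoc _ _ _) (by
    change x.cen + y.cen + x.fst * y.snd + z.cen + (x.fst + y.fst) * z.snd =
      x.cen + (y.cen + z.cen + y.fst * z.snd) + x.fst * (y.snd + z.snd)
    ring)
  one_mul x := Heis.ext (zero_add _) (zero_add _) (by
    change 0 + x.cen + 0 * x.snd = x.cen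
    ring)
  mul_one x := Heis.ext (add_zero _) (add_zero _) (by
    change x.cen + 0 + x.fst * 0 = x.cen
    ring)
  inv_mul_cancel x := Heis.ext (neg_add_cancel _) (neg_add_cancel _) (by
    change -x.cen + x.fst * x.snd + x.cen + -x.fst * x.snd = 0
    ring)

theorem Heis.commute_iff {x y : Heis} : Commute x y ↔ x.fst * y.snd = y.fst * x.snd := by
  rw [commute_iff_eq, Heis.ext_iff]
  change x.fst + y.fst = y.fst + x.fst ∧ x.snd + y.snd = y.snd + x.snd ∧
    x.cen + y.cen + x.fst * y.snd = y.cen + x.cen + y.fst * x.snd ↔ _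
  simp [add_comm]

/-- The first coordinate as a homomorphism. -/
def Heis.fstHom : Heis →* Multiplicative (ZMod 2) where
  toFun x := Multiplicative.ofAdd x.fst
  map_one' := rfl
  map_mul' _ _ := rfl

/-- The second coordinate as a homomorphism. -/
def Heis.sndHom : Heis →* Multiplicative (ZMod 2) where
  toFun x := Multiplicative.ofAdd x.snd
  map_one' := rfl
  map_mul' _ _ := rfl

/-- Two `ℤ/2`-valued characters have trivial cup product when they lift jointly to the Heisenberg
group. -/
def CupTrivial {G : Type} [Group G] (f g : G →* Multiplicative (ZMod 2)) : Prop :=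
  ∃ φ : G →* Heis, Heis.fstHom.comp φ = f ∧ Heis.sndHom.comp φ = g

theorem CupTrivial.comp {G H : Type} [Group G] [Group H] {f g : G →* Multiplicative (ZMod 2)}
    (h : CupTrivial f g) (e : H →* G) : CupTrivial (f.comp e) (g.comp e) := by
  obtain ⟨φ, rfl, rfl⟩ := h
  exact ⟨φ.comp e, rfl, rfl⟩

variable {V W : Type} {Γ : SimpleGraph V} {Λ : SimpleGraph W}

/-- The character of `Raag Γ` with prescribed values on the vertices. -/
def raagChar (Γ : SimpleGraph V) (f : V → ZMod 2) : Raag Γ →* Multiplicative (ZMod 2) :=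
  raagLift (fun v => Multiplicative.ofAdd (f v)) fun _ _ _ => Commute.all _ _

@[simp]
theorem raagChar_gen (f : V → ZMod 2) (v : V) :
    raagChar Γ f (gen Γ v) = Multiplicative.ofAdd (f v) :=
  raagLift_gen _ _ _

theorem raagChar_injective : Function.Injective (raagChar Γ) := fun f g h => by
  ext v
  simpa using DFunLike.congr_fun h (gen Γ v)

/-- The functions `f` and `g` are proportional along every edge of `Γ`. -/
def EdgeProp (Γ : SimpleGraph V) (f g : V → ZMod 2) : Prop :=
  ∀ u v, Γ.Adj u v → f u * g v = f v * g u

theorem EdgeProp.symm {f g : V → ZMod 2} (h : EdgeProp Γ f g) : EdgeProp Γ g f :=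
  fun u v huv => by rw [mul_comm, ← h u v huv, mul_comm]

theorem cupTrivial_raagChar_iff {f g : V → ZMod 2} :
    CupTrivial (raagChar Γ f) (raagChar Γ g) ↔ EdgeProp Γ f g := by
  constructor
  · rintro ⟨φ, hf, hg⟩ u v huv
    have hf' (v) : (φ (gen Γ v)).fst = f v := by
      have := DFunLike.congr_fun hf (gen Γ v)
      rw [raagChar_gen] at this
      exact Multiplicative.ofAdd.injective this
    have hg' (v) : (φ (gen Γ v)).snd = g v := by
      have := DFunLike.congr_fun hg (gen Γ v)
      rw [raagChar_gen] at this
      exact Multiplicative.ofAdd.injective this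
    have := Heis.commute_iff.1 ((commute_gen huv).map φ)
    simpa only [hf', hg'] using this
  · intro h
    exact ⟨raagLift (fun v => ⟨f v, g v, 0⟩) fun u v huv => Heis.commute_iff.2 (h u v huv),
      raagHom_ext fun v => by simp [Heis.fstHom], raagHom_ext fun v => by simp [Heis.sndHom]⟩

/-- Transport of characters, in vertex coordinates, along a homomorphism. -/
def transportChar (e : Raag Λ →* Raag Γ) (f : V → ZMod 2) : W → ZMod 2 :=
  fun w => (raagChar Γ f (e (gen Λ w))).toAdd

theorem raagChar_transportChar (e : Raag Λ →* Raag Γ) (f : V → ZMod 2) :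
    raagChar Λ (transportChar e f) = (raagChar Γ f).comp e :=
  raagHom_ext fun v => by simp [transportChar]

theorem EdgeProp.transportChar {f g : V → ZMod 2} (h : EdgeProp Γ f g) (e : Raag Λ →* Raag Γ) :
    EdgeProp Λ (transportChar e f) (transportChar e g) := by
  rw [← cupTrivial_raagChar_iff, raagChar_transportChar, raagChar_transportChar]
  exact (cupTrivial_raagChar_iff.2 h).comp _

theorem raagChar_add (f g : V → ZMod 2) : raagChar Γ (f + g) = raagChar Γ f * raagChar Γ g :=
  raagHom_ext fun v => by simp

/-- An isomorphism of right-angled Artin groups induces an isomorphism of their spaces of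
characters preserving triviality of cup products. -/
theorem exists_addEquiv_edgeProp (e : Raag Γ ≃* Raag Λ) :
    ∃ Φ : (V → ZMod 2) ≃+ (W → ZMod 2), ∀ f g, EdgeProp Γ f g ↔ EdgeProp Λ (Φ f) (Φ g) := by
  have hl (f) : transportChar (e : Raag Γ →* Raag Λ)
      (transportChar (e.symm : Raag Λ →* Raag Γ) f) = f := by
    apply raagChar_injective (Γ := Γ)
    rw [raagChar_transportChar, raagChar_transportChar]
    ext x
    simp
  have hr (f) : transportChar (e.symm : Raag Λ →* Raag Γ)
      (transportChar (e : Raag Γ →* Raag Λ) f) = f := by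
    apply raagChar_injective (Γ := Λ)
    rw [raagChar_transportChar, raagChar_transportChar]
    ext x
    simp
  refine ⟨⟨⟨transportChar (e.symm : Raag Λ →* Raag Γ), transportChar (e : Raag Γ →* Raag Λ),
    hl, hr⟩, fun f g => ?_⟩, fun f g => ?_⟩
  · ext w
    simp [transportChar, raagChar_add]
  · change _ ↔ EdgeProp Λ (transportChar (e.symm : Raag Λ →* Raag Γ) f)
      (transportChar (e.symm : Raag Λ →* Raag Γ) g)
    exact ⟨fun h => h.transportChar _, fun h => by
      simpa only [hl] using h.transportChar (e : Raag Γ →* Raag Λ)⟩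

end CupProduct

section Invariants

variable {V W : Type} {Γ : SimpleGraph V} {Λ : SimpleGraph W}

theorem zmod_two_eq_one {x : ZMod 2} (h : x ≠ 0) : x = 1 := by
  revert x; decide

theorem exists_eq_one {f : V → ZMod 2} (h : f ≠ 0) : ∃ u, f u = 1 := by
  obtain ⟨u, hu⟩ := Function.ne_iff.1 h
  exact ⟨u, zmod_two_eq_one hu⟩

theorem edgeProp_of_part (hΓ : Γ.IsCompleteMultipartite) {f g : V → ZMod 2} {u : V}
    (hf : ∀ x, Γ.Adj u x → f x = 0) (hg : ∀ x, Γ.Adj u x → g x = 0) : EdgeProp Γ f g := by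
  intro x y hxy
  have : Γ.Adj u x ∨ Γ.Adj u y := by
    by_contra! h
    exact hΓ.trans x u y (fun h' => h.1 h'.symm) h.2 hxy
  rcases this with h | h
  · simp [hf x h, hg x h]
  · simp [hf y h, hg y h]

/-- In a complete multipartite graph, functions proportional along every edge are either equal or
supported on a common part. -/
theorem EdgeProp.eq_or_part (hΓ : Γ.IsCompleteMultipartite) {f g : V → ZMod 2}
    (h : EdgeProp Γ f g) {u : V} (hu : f u = 1) (hg : g ≠ 0) :
    f = g ∨ (∀ x, Γ.Adj u x → f x = 0) ∧ ∀ x, Γ.Adj u x → g x = 0 := by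
  by_cases hf : ∀ x, Γ.Adj u x → f x = 0
  · refine Or.inr ⟨hf, fun x hx => ?_⟩
    simpa [hu, hf x hx] using h u x hx
  · left
    push Not at hf
    obtain ⟨w, huw, hw⟩ := hf
    replace hw := zmod_two_eq_one hw
    have hgw : g w = g u := by simpa [hu, hw] using h u w huw
    have key (x) : g x = f x * g u := by
      have : Γ.Adj u x ∨ Γ.Adj w x := by
        by_contra! hc
        exact hΓ.trans u x w hc.1 (fun h' => hc.2 h'.symm) huw
      rcases this with hx | hx
      · simpa [hu] using h u x hx
      · simpa [hw, hgw] using h w x hx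
    have hgu : g u = 1 := by
      refine zmod_two_eq_one fun h0 => hg ?_
      ext x
      simp [key x, h0]
    ext x
    simp [key x, hgu]

section
open Classical

theorem edgeProp_single_iff {u : V} {g : V → ZMod 2} :
    EdgeProp Γ (Pi.single u 1) g ↔ ∀ x, Γ.Adj u x → g x = 0 := by
  constructor
  · intro h x hx
    simpa [hx.ne'] using h u x hx
  · intro h x y hxy
    by_cases hx : x = u
    · subst hx
      simp [hxy.ne', h y hxy]
    · by_cases hy : y = u
      · subst hy
        simp [hxy.ne, h x hxy.symm]
      · simp [hx, hy]

theorem edgeProp_single_single_iff {u v : V} :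
    EdgeProp Γ (Pi.single u 1) (Pi.single v 1) ↔ ¬ Γ.Adj u v := by
  rw [edgeProp_single_iff]
  constructor
  · intro h huv
    simpa using h v huv
  · intro h x hx
    rw [Pi.single_eq_of_ne]
    rintro rfl
    exact h hx

theorem isCompleteMultipartite_iff_edgeProp_trans :
    Γ.IsCompleteMultipartite ↔
      ∀ f g h, g ≠ 0 → EdgeProp Γ f g → EdgeProp Γ g h → EdgeProp Γ f h := by
  constructor
  · intro hΓ f g h hg hfg hgh
    by_cases hf : f = 0
    · subst hf; intro x y _; simp
    by_cases hh : h = 0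
    · subst hh; intro x y _; simp
    obtain ⟨u, hu⟩ := exists_eq_one hg
    rcases hfg.symm.eq_or_part hΓ hu hf with rfl | ⟨-, hf'⟩
    · exact hgh
    rcases hgh.eq_or_part hΓ hu hh with rfl | ⟨-, hh'⟩
    · exact hfg
    exact edgeProp_of_part hΓ hf' hh'
  · intro H
    refine ⟨fun u v w huv hvw => ?_⟩
    rw [← edgeProp_single_single_iff] at *
    exact H _ _ _ (by simp) huv hvw

/-- The functions supported on `S` are the functions on `S`. -/
theorem card_supported [Finite V] (S : Set V) :
    Nat.card {f : V → ZMod 2 // ∀ x, x ∉ S → f x = 0} = 2 ^ S.ncard := by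
  have : {f : V → ZMod 2 // ∀ x, x ∉ S → f x = 0} ≃ (S → ZMod 2) :=
    { toFun := fun f x => f.1 x
      invFun := fun f => ⟨fun x => if h : x ∈ S then f ⟨x, h⟩ else 0, fun x hx => by simp [hx]⟩
      left_inv := fun f => by
        ext x
        by_cases h : x ∈ S
        · simp [h]
        · simp [h, f.2 x h]
      right_inv := fun f => by ext x; simp }
  rw [Nat.card_congr this, Nat.card_fun, Nat.card_zmod, Nat.card_coe_set_eq]

theorem card_edgeProp_single [Finite V] (u : V) :
    Nat.card {g // EdgeProp Γ (Pi.single u 1) g} = 2 ^ {v | ¬ Γ.Adj u v}.ncard := by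
  rw [← card_supported]
  exact Nat.card_congr (Equiv.subtypeEquivRight fun g => by simp [edgeProp_single_iff])

theorem ncard_part_ne_two_iff [Finite V] (hΓ : Γ.IsCompleteMultipartite) :
    (∀ u, {v | ¬ Γ.Adj u v}.ncard ≠ 2) ↔
      ∀ f, f ≠ 0 → Nat.card {g // EdgeProp Γ f g} ≠ 4 := by
  constructor
  · intro H f hf
    obtain ⟨u, hu⟩ := exists_eq_one hf
    by_cases hp : ∀ x, Γ.Adj u x → f x = 0
    · have htr := isCompleteMultipartite_iff_edgeProp_trans.1 hΓ
      have hsf : EdgeProp Γ (Pi.single u 1) f := edgeProp_single_iff.2 hp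
      have : Nat.card {g // EdgeProp Γ f g} = Nat.card {g // EdgeProp Γ (Pi.single u 1) g} :=
        Nat.card_congr (Equiv.subtypeEquivRight fun g =>
          ⟨fun h => htr _ _ _ hf hsf h, fun h => htr _ _ _ (by simp) hsf.symm h⟩)
      rw [this, card_edgeProp_single]
      intro h4
      exact H u (Nat.pow_right_injective le_rfl (h4.trans (by norm_num : 4 = 2 ^ 2)))
    · intro h4
      have hsub : {g | EdgeProp Γ f g} ⊆ {0, f} := by
        intro g hg
        by_cases hg0 : g = 0
        · simp [hg0]
        · rcases EdgeProp.eq_or_part hΓ hg hu hg0 with rfl | h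
          · simp
          · exact absurd h.1 hp
      have h1 := Set.ncard_le_ncard hsub (Set.toFinite _)
      have h2 := Set.ncard_insert_le (0 : V → ZMod 2) {f}
      rw [Set.ncard_singleton] at h2
      rw [← Nat.card_coe_set_eq] at h1
      change Nat.card {g // EdgeProp Γ f g} ≤ _ at h1
      omega
  · intro H u hu
    refine H (Pi.single u 1) (by simp) ?_
    rw [card_edgeProp_single, hu]
    rfl

/-- The functions which are proportional along edges to a function other than themselves and `0`. -/
def degenerate (Γ : SimpleGraph V) : Set (V → ZMod 2) :=
  {f | ∃ g, g ≠ 0 ∧ f ≠ g ∧ EdgeProp Γ f g}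

theorem mem_closure_degenerate_iff [Finite V] {f : V → ZMod 2} :
    f ∈ AddSubgroup.closure (degenerate Γ) ↔ ∀ u, u ∉ (univVerts Γ)ᶜ → f u = 0 := by
  constructor
  · intro hf u hu
    rw [Set.notMem_compl_iff] at hu
    induction hf using AddSubgroup.closure_induction with
    | zero => rfl
    | add x y _ _ hx hy => simp [hx, hy]
    | neg x _ hx => simp [hx]
    | mem f hf =>
      obtain ⟨g, hg, hne, h⟩ := hf
      by_contra hfu
      replace hfu := zmod_two_eq_one hfu
      have key (x) : g x = f x * g u := by
        by_cases hx : x = u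
        · subst hx; simp [hfu]
        · simpa [hfu] using h u x (hu x hx)
      have hgu : g u = 1 := zmod_two_eq_one fun h0 => hg (by ext x; simp [key x, h0])
      exact hne (by ext x; simp [key x, hgu])
  · intro hf
    have := Fintype.ofFinite V
    rw [← Finset.univ_sum_single f]
    refine AddSubgroup.sum_mem _ fun u _ => ?_
    by_cases h0 : f u = 0
    · simp [h0]
    rw [zmod_two_eq_one h0]
    have hu : ¬ u ∈ univVerts Γ := fun hu => h0 (hf u (by simpa using hu))
    simp only [univVerts, Set.mem_ofPred_eq, not_forall] at hu
    obtain ⟨v, hvu, huv⟩ := hu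
    refine AddSubgroup.subset_closure ⟨Pi.single v 1, by simp, fun h => ?_,
      edgeProp_single_single_iff.2 huv⟩
    have := congrFun h v
    simp [hvu] at this

theorem card_closure_degenerate [Finite V] :
    Nat.card (AddSubgroup.closure (degenerate Γ)) = 2 ^ (univVerts Γ)ᶜ.ncard := by
  rw [← card_supported]
  exact Nat.card_congr (Equiv.subtypeEquivRight fun f => mem_closure_degenerate_iff)

theorem ncard_univVerts_eq [Finite V] [Finite W] (Φ : (V → ZMod 2) ≃+ (W → ZMod 2))
    (hΦ : ∀ f g, EdgeProp Γ f g ↔ EdgeProp Λ (Φ f) (Φ g)) :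
    (univVerts Γ).ncard = (univVerts Λ).ncard := by
  have hV : Nat.card V = Nat.card W := by
    have := Nat.card_congr Φ.toEquiv
    rw [Nat.card_fun, Nat.card_fun, Nat.card_zmod] at this
    exact Nat.pow_right_injective le_rfl this
  have himage : Φ '' degenerate Γ = degenerate Λ := by
    ext f
    obtain ⟨f, rfl⟩ := Φ.surjective f
    rw [Φ.injective.mem_set_image]
    constructor
    · rintro ⟨g, hg, hne, h⟩
      exact ⟨Φ g, by simpa using hg, by simpa using hne, (hΦ _ _).1 h⟩
    · rintro ⟨g, hg, hne, h⟩
      obtain ⟨g, rfl⟩ := Φ.surjective g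
      exact ⟨g, by simpa using hg, by simpa using hne, (hΦ _ _).2 h⟩
  have hmap : (AddSubgroup.closure (degenerate Γ)).map (Φ : (V → ZMod 2) →+ (W → ZMod 2)) =
      AddSubgroup.closure (degenerate Λ) := by
    rw [AddMonoidHom.map_closure, ← himage]
    rfl
  have hcard := Nat.card_congr
    ((AddSubgroup.closure (degenerate Γ)).equivMapOfInjective
      (Φ : (V → ZMod 2) →+ (W → ZMod 2)) Φ.injective).toEquiv
  rw [hmap, card_closure_degenerate, card_closure_degenerate] at hcard
  have hcompl := Nat.pow_right_injective le_rfl hcard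
  have h1 := Set.ncard_add_ncard_compl (univVerts Γ)
  have h2 := Set.ncard_add_ncard_compl (univVerts Λ)
  change (univVerts Γ)ᶜ.ncard = (univVerts Λ)ᶜ.ncard at hcompl
  omega

theorem IsBMultipartite.of_raag_mulEquiv [Finite V] [Finite W] (hΛ : IsBMultipartite Λ)
    (e : Raag Γ ≃* Raag Λ) : IsBMultipartite Γ := by
  obtain ⟨Φ, hΦ⟩ := exists_addEquiv_edgeProp e
  have hT : Γ.IsCompleteMultipartite := by
    rw [isCompleteMultipartite_iff_edgeProp_trans]
    intro f g h hg hfg hgh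
    rw [hΦ] at *
    exact isCompleteMultipartite_iff_edgeProp_trans.1 hΛ.isCompleteMultipartite _ _ _
      (by simpa using hg) hfg hgh
  refine ⟨hT, ?_, ?_⟩
  · rw [ncard_part_ne_two_iff hT]
    intro f hf
    rw [Nat.card_congr (Φ.toEquiv.subtypeEquiv fun g => hΦ f g :
      {g // EdgeProp Γ f g} ≃ {g // EdgeProp Λ (Φ f) g})]
    exact (ncard_part_ne_two_iff hΛ.isCompleteMultipartite).1 hΛ.ncard_part_ne_two _
      (by simpa using hf)
  · rw [ncard_univVerts_eq Φ hΦ]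
    exact hΛ.ncard_univVerts_ne_two

end

end Invariants

section Classification

variable {V : Type} [Fintype V] {Γ : SimpleGraph V}

open Classical in
theorem IsBMultipartite.exists_iso_modelGraph (h : IsBMultipartite Γ) :
    ∃ (k a : ℕ) (n : Fin k → ℕ), (∀ i, 3 ≤ n i) ∧ a ≠ 2 ∧ Nonempty (Γ ≃g modelGraph n a) := by
  let r := h.isCompleteMultipartite.setoid
  let β (c : Quotient r) : Type := {x // r c.out x}
  let p (c : Quotient r) : Prop := Nat.card (β c) = 1
  let n (i : Fin (Fintype.card {c // ¬ p c})) : ℕ := Nat.card (β ((Fintype.equivFin _).symm i).1)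
  let e : Fin (Fintype.card {c // ¬ p c}) ⊕ Fin (Fintype.card {c // p c}) ≃ Quotient r :=
    ((Equiv.sumComm _ _).trans
      (Equiv.sumCongr (Fintype.equivFin _).symm (Fintype.equivFin _).symm)).trans
      (Equiv.sumCompl p)
  have hβ (s) : Nonempty (modelPart n (Fintype.card {c // p c}) s ≃ β (e s)) := by
    rcases s with i | j
    · exact ⟨(Finite.equivFin _).symm⟩
    · have : Nat.card (β (e (Sum.inr j))) = 1 := ((Fintype.equivFin {c // p c}).symm j).2
      obtain ⟨h1, ⟨x⟩⟩ := Nat.card_eq_one_iff_unique.1 this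
      have : Unique (β (e (Sum.inr j))) := ⟨⟨x⟩, fun y => Subsingleton.elim _ _⟩
      exact ⟨(Equiv.ofUnique Unit _ : Unit ≃ β (e (Sum.inr j)))⟩
  have hn (i) : 3 ≤ n i := by
    set c := (Fintype.equivFin _).symm i with hc
    have h0 : 0 < Nat.card (β c.1) :=
      have : Nonempty (β c.1) := ⟨⟨_, r.refl _⟩⟩
      Nat.card_pos
    have h1 : Nat.card (β c.1) ≠ 1 := c.2
    have h2 : Nat.card (β c.1) ≠ 2 := h.ncard_part_ne_two c.1.out
    change 3 ≤ Nat.card (β c.1)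
    omega
  let F : Γ ≃g modelGraph n (Fintype.card {c // p c}) :=
    h.isCompleteMultipartite.iso.trans
      (RelIso.symm ⟨Equiv.sigmaCongr e fun s => (hβ s).some, fun {u v} => e.injective.ne_iff⟩)
  refine ⟨_, Fintype.card {c // p c}, n, hn, ?_, ⟨F⟩⟩
  rw [← ncard_univVerts_modelGraph (a := Fintype.card {c // p c}) hn, ← ncard_univVerts_congr F]
  exact h.ncard_univVerts_ne_two

open Classical in
theorem classSizes_eq [DecidableEq V] {k a : ℕ} {n : Fin k → ℕ} (hn : ∀ i, 3 ≤ n i) (e : Γ ≃g modelGraph n a) :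
    classSizes Γ = (↑(List.ofFn n) : Multiset ℕ) + (if a = 0 then 0 else {a}) := by
  have hadj (u v) : Γ.Adj u v ↔ (e u).1 ≠ (e v).1 := e.map_rel_iff.symm
  have hT : Γ.IsCompleteMultipartite := by
    refine ⟨fun u v w => ?_⟩
    simp only [hadj, not_not]
    exact Eq.trans
  have huniv (v) : v ∈ univVerts Γ ↔ ∃ j, (e v).1 = Sum.inr j := by
    rw [mem_univVerts_iff e, univVerts_modelGraph hn]
    constructor
    · rintro ⟨j, hj⟩
      exact ⟨j, by rw [← hj]⟩
    · rintro ⟨j, hj⟩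
      exact ⟨j, Sigma.ext hj.symm (by
        generalize e v = x at hj
        obtain ⟨s, y⟩ := x
        obtain rfl : s = Sum.inr j := hj
        rfl)⟩
  let A (i : Fin k) : Finset V := {v | (e v).1 = Sum.inl i}
  let U : Finset V := (univVerts Γ).toFinset
  have hA (i) : (A i).card = n i := by
    have : (A i : Set V).ncard = {v : Σ s, modelPart n a s | v.1 = Sum.inl i}.ncard := by
      rw [← Nat.card_coe_set_eq, ← Nat.card_coe_set_eq]
      exact Nat.card_congr (e.toEquiv.subtypeEquiv fun v => by simp [A])
    rw [← Set.ncard_coe_finset, this, ncard_modelPart]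
    simp
  have hU : U.card = a := by
    rw [← Set.ncard_coe_finset, Set.coe_toFinset, ncard_univVerts_congr e,
      ncard_univVerts_modelGraph hn]
  have hclass (v) : (simClass Γ v).toFinset =
      Sum.elim A (fun _ => U) (e v).1 := by
    ext u
    rw [Set.mem_toFinset]
    change Sim Γ u v ↔ _
    rw [sim_iff hT, hadj, not_not, huniv, huniv]
    rcases h : (e v).1 with i | j
    · simp [A]
    · simp only [Sum.elim_inr, U, Set.mem_toFinset, huniv]
      constructor
      · rintro (h' | h')
        · exact ⟨j, h'⟩
        · exact h'.1
      · exact fun h' => Or.inr ⟨h', j, rfl⟩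
  have hAne (i) : (A i).Nonempty := Finset.card_pos.1 (by have := hn i; rw [hA]; omega)
  have hAinj : Function.Injective A := by
    intro i j hij
    obtain ⟨v, hv⟩ := hAne i
    have hv' := hij ▸ hv
    simp only [A, Finset.mem_filter_univ] at hv hv'
    exact Sum.inl_injective (hv.symm.trans hv')
  have hAU (i) : A i ≠ U := by
    intro h
    obtain ⟨v, hv⟩ := hAne i
    have hv' := h ▸ hv
    simp only [A, U, Finset.mem_filter_univ, Set.mem_toFinset, huniv] at hv hv'
    simp [hv] at hv'
  have himage : Finset.image (fun v => (simClass Γ v).toFinset) Finset.univ =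
      Finset.image A Finset.univ ∪ (if a = 0 then ∅ else {U}) := by
    simp only [hclass]
    ext s
    simp only [Finset.mem_image, Finset.mem_univ, true_and, Finset.mem_union]
    constructor
    · rintro ⟨v, rfl⟩
      rcases (e v).1 with i | j
      · exact Or.inl ⟨i, rfl⟩
      · have : a ≠ 0 := by have := j.2; omega
        simp [this]
    · rintro (⟨i, rfl⟩ | hs)
      · obtain ⟨v, hv⟩ := hAne i
        simp only [A, Finset.mem_filter_univ] at hv
        exact ⟨v, by rw [hv, Sum.elim_inl]⟩
      · split_ifs at hs with ha
        · simp at hs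
        · rw [Finset.mem_singleton] at hs
          subst hs
          exact ⟨e.symm ⟨Sum.inr ⟨0, Nat.pos_of_ne_zero ha⟩, ()⟩, by simp⟩
  have hdisj : Disjoint (Finset.image A Finset.univ) (if a = 0 then ∅ else {U}) := by
    split_ifs
    · simp
    · simpa using hAU
  rw [classSizes, himage, ← Finset.disjUnion_eq_union _ _ hdisj, Finset.disjUnion_val,
    Multiset.map_add, Finset.image_val_of_injOn hAinj.injOn, Multiset.map_map, ← Fin.univ_val_map]
  congr 1
  · exact Multiset.map_congr rfl fun i _ => hA i
  · split_ifs <;> simp [hU]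

end Classification

theorem propertyB_iff_product_of_free_groups (Γ : SimpleGraph V) :
    ((B1 Γ ∧ B2 Γ) ↔ ∃ (k a : ℕ) (n : Fin k → ℕ), (∀ i, 3 ≤ n i) ∧ a ≠ 2 ∧
        Nonempty (Raag Γ ≃*
          ((∀ i : Fin k, FreeGroup (Fin (n i))) × (Fin a → Multiplicative ℤ)))) ∧
    ((B1 Γ ∧ B2 Γ) → ∃ (k a : ℕ) (n : Fin k → ℕ), (∀ i, 3 ≤ n i) ∧ a ≠ 2 ∧
        Nonempty (Raag Γ ≃*
          ((∀ i : Fin k, FreeGroup (Fin (n i))) × (Fin a → Multiplicative ℤ))) ∧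
        classSizes Γ = (↑(List.ofFn n) : Multiset ℕ) + (if a = 0 then 0 else {a})) := by
  have key (h : B1 Γ ∧ B2 Γ) : ∃ (k a : ℕ) (n : Fin k → ℕ), (∀ i, 3 ≤ n i) ∧ a ≠ 2 ∧
        Nonempty (Raag Γ ≃*
          ((∀ i : Fin k, FreeGroup (Fin (n i))) × (Fin a → Multiplicative ℤ))) ∧
        classSizes Γ = (↑(List.ofFn n) : Multiset ℕ) + (if a = 0 then 0 else {a}) := by
    obtain ⟨k, a, n, hn, ha, ⟨e⟩⟩ := (isBMultipartite_of_property h.1 h.2).exists_iso_modelGraph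
    exact ⟨k, a, n, hn, ha, ⟨(raagCongr e).trans (raagModelGraph n a)⟩, classSizes_eq hn e⟩
  refine ⟨⟨fun h => ?_, ?_⟩, key⟩
  · obtain ⟨k, a, n, hn, ha, e, -⟩ := key h
    exact ⟨k, a, n, hn, ha, e⟩
  · rintro ⟨k, a, n, hn, ha, ⟨e⟩⟩
    have : ∀ s, Finite (modelPart n a s) := by
      rintro (i | j)
      · exact inferInstanceAs (Finite (Fin (n i)))
      · exact inferInstanceAs (Finite Unit)
    exact ((isBMultipartite_modelGraph hn ha).of_raag_mulEquiv
      (e.trans (raagModelGraph n a).symm)).property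

end RaagPaper
end

section
/- Let Γ be a finite simplicial graph satisfying property (B1), and let v be a vertex with st(v) ≠ V. Then the induced subgraph on V − st(v) is totally disconnected, i.e. it contains no edges; in particular every vertex u ∉ st(v) forms by itself a connected component {u} of the induced subgraph on V − st(v). -/
open SimpleGraph

namespace RaagPaper

variable {V : Type} [Fintype V] [DecidableEq V]

theorem complement_of_star_totally_disconnected (Γ : SimpleGraph V)
    (hB1 : B1 Γ) (v : V) (hv : st Γ v ≠ Set.univ) :
    (∀ u₁ u₂ : V, u₁ ∉ st Γ v → u₂ ∉ st Γ v → ¬ Γ.Adj u₁ u₂) ∧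
    (∀ u : V, u ∉ st Γ v → IsCompOf Γ ((st Γ v)ᶜ) {u}) := by
  have no_edge : ∀ u₁ u₂ : V, u₁ ∉ st Γ v → u₂ ∉ st Γ v → ¬ Γ.Adj u₁ u₂ := by
    intro u₁ u₂ h₁ h₂ hadj
    have hne : u₁ ≠ v := fun h => h₁ (h ▸ Set.mem_insert _ _)
    have hnadj : ¬ Γ.Adj u₁ v := fun h => h₁ (Set.mem_insert_of_mem _ h.symm)
    exact h₂ ((hB1 u₁ v hne hnadj).1 hadj)
  refine ⟨no_edge, fun u hu => ?_⟩
  have hbot : Γ.induce (st Γ v)ᶜ = ⊥ := by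
    ext x y
    simpa using no_edge x y x.2 y.2
  refine ⟨(Γ.induce (st Γ v)ᶜ).connectedComponentMk ⟨u, hu⟩, ?_⟩
  have hsupp : ((Γ.induce (st Γ v)ᶜ).connectedComponentMk ⟨u, hu⟩).supp = {⟨u, hu⟩} := by
    ext x
    rw [ConnectedComponent.mem_supp_iff, ConnectedComponent.eq, hbot, reachable_bot,
      Set.mem_singleton_iff]
  rw [hsupp, Set.image_singleton]

end RaagPaper
end

section
/- Let Γ be a finite simplicial graph satisfying property (B1), and let v, w be distinct vertices with v ∉ lk(w). Let c₁ ∈ Aut(A_Γ) be the partial conjugation c_{w,{v}} sending v ↦ w⁻¹vw and fixing all other generators. Then there exist t, c₂ ∈ Aut(A_Γ) such that c₁^m = t^{-m} c₂ t^m c₂⁻¹ for all m ≥ 0; in particular, c₁^m lies in the commutator subgroup of SIA_Γ(m) for all m ≥ 0. -/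
open SimpleGraph

namespace RaagPaper

variable {V : Type} [Fintype V] [DecidableEq V]

/-- Adjacent generators commute. -/
theorem gen_commute {W : Type} {Γ : SimpleGraph W} {a b : W} (h : Γ.Adj a b) :
    Commute (gen Γ a) (gen Γ b) := by
  have hr : (PresentedGroup.mk (Rels Γ))
      (FreeGroup.of a * FreeGroup.of b * (FreeGroup.of a)⁻¹ * (FreeGroup.of b)⁻¹) = 1 :=
    PresentedGroup.one_of_mem ⟨a, b, h, rfl⟩
  simp only [map_mul, map_inv] at hr
  exact mul_inv_eq_iff_eq_mul.mp (mul_inv_eq_one.mp hr)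

/-- Homomorphisms out of `Raag Γ` are determined by their values on generators. -/
theorem raag_hom_ext {W : Type} {Γ : SimpleGraph W} {G : Type*} [Group G] {f g : Raag Γ →* G}
    (h : ∀ z, f (gen Γ z) = g (gen Γ z)) : f = g :=
  PresentedGroup.ext h

/-- Automorphisms of `Raag Γ` are determined by their values on generators. -/
theorem raag_aut_ext {W : Type} {Γ : SimpleGraph W} {α β : MulAut (Raag Γ)}
    (h : ∀ z, α (gen Γ z) = β (gen Γ z)) : α = β :=
  MulEquiv.toMonoidHom_injective (raag_hom_ext h)

/-- A map on vertices preserving the commutation relations extends to `Raag Γ`. -/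
theorem exists_raag_hom {W : Type} {Γ : SimpleGraph W} {G : Type*} [Group G] (f : W → G)
    (hf : ∀ a b, Γ.Adj a b → Commute (f a) (f b)) :
    ∃ F : Raag Γ →* G, ∀ z, F (gen Γ z) = f z := by
  have hrel : ∀ r ∈ Rels Γ, FreeGroup.lift f r = 1 := by
    rintro r ⟨a, b, hab, rfl⟩
    simp only [map_mul, map_inv, FreeGroup.lift_apply_of]
    rw [(hf a b hab).eq]
    group
  exact ⟨PresentedGroup.toGroup hrel, fun z => PresentedGroup.toGroup.of hrel⟩

/-- Changing the image of a single generator `v` to an element commuting with the link of `v`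
extends to an endomorphism. -/
theorem exists_raag_hom_update {W : Type} [DecidableEq W] {Γ : SimpleGraph W} (v : W) (g : Raag Γ)
    (hg : ∀ a, Γ.Adj v a → Commute g (gen Γ a)) :
    ∃ F : Raag Γ →* Raag Γ, F (gen Γ v) = g ∧ ∀ z, z ≠ v → F (gen Γ z) = gen Γ z := by
  obtain ⟨F, hF⟩ := exists_raag_hom (Γ := Γ) (Function.update (gen Γ) v g) (by
    intro a b hab
    by_cases ha : a = v
    · subst ha
      rw [Function.update_self, Function.update_of_ne hab.ne']
      exact hg b hab
    · by_cases hb : b = v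
      · subst hb
        rw [Function.update_self, Function.update_of_ne ha]
        exact (hg a hab.symm).symm
      · rw [Function.update_of_ne ha, Function.update_of_ne hb]
        exact gen_commute hab)
  exact ⟨F, by rw [hF, Function.update_self], fun z hz => by rw [hF, Function.update_of_ne hz]⟩

/-- An automorphism changing a single generator, from mutually inverse endomorphisms. -/
theorem exists_raag_aut_update {W : Type} [DecidableEq W] {Γ : SimpleGraph W} (v : W)
    (g g' : Raag Γ)
    (hg : ∀ a, Γ.Adj v a → Commute g (gen Γ a)) (hg' : ∀ a, Γ.Adj v a → Commute g' (gen Γ a))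
    (hinv : ∀ F : Raag Γ →* Raag Γ, F (gen Γ v) = g → (∀ z, z ≠ v → F (gen Γ z) = gen Γ z) →
      F g' = gen Γ v)
    (hinv' : ∀ F : Raag Γ →* Raag Γ, F (gen Γ v) = g' → (∀ z, z ≠ v → F (gen Γ z) = gen Γ z) →
      F g = gen Γ v) :
    ∃ α : MulAut (Raag Γ), α (gen Γ v) = g ∧ ∀ z, z ≠ v → α (gen Γ z) = gen Γ z := by
  obtain ⟨F, hFv, hFz⟩ := exists_raag_hom_update v g hg
  obtain ⟨F', hFv', hFz'⟩ := exists_raag_hom_update v g' hg'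
  refine ⟨MonoidHom.toMulEquiv F F' (raag_hom_ext fun z => ?_) (raag_hom_ext fun z => ?_),
    hFv, hFz⟩
  · by_cases hz : z = v
    · subst hz
      simpa [hFv] using hinv' F' hFv' hFz'
    · simp [hFz z hz, hFz' z hz]
  · by_cases hz : z = v
    · subst hz
      simpa [hFv'] using hinv F hFv hFz
    · simp [hFz z hz, hFz' z hz]

/-- The transvection `t_{vw}` exists when the link of `v` lies in the link of `w`. -/
theorem exists_transvection {W : Type} [DecidableEq W] {Γ : SimpleGraph W} {v w : W} (hvw : v ≠ w)
    (hlk : ∀ a, Γ.Adj v a → Γ.Adj w a) :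
    ∃ α : MulAut (Raag Γ), α (gen Γ v) = gen Γ v * gen Γ w ∧
      ∀ z, z ≠ v → α (gen Γ z) = gen Γ z := by
  refine exists_raag_aut_update v _ (gen Γ v * (gen Γ w)⁻¹)
    (fun a ha => (gen_commute ha).mul_left (gen_commute (hlk a ha)))
    (fun a ha => (gen_commute ha).mul_left (gen_commute (hlk a ha)).inv_left) ?_ ?_ <;>
  · intro F hv hz
    simp [hv, hz w hvw.symm]

/-- The partial conjugation `c_{v,{w}}` exists when the link of `w` lies in the link of `v`. -/
theorem exists_partialConj {W : Type} [DecidableEq W] {Γ : SimpleGraph W} {v w : W} (hvw : v ≠ w)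
    (hlk : ∀ a, Γ.Adj w a → Γ.Adj v a) :
    ∃ α : MulAut (Raag Γ), α (gen Γ w) = (gen Γ v)⁻¹ * gen Γ w * gen Γ v ∧
      ∀ z, z ≠ w → α (gen Γ z) = gen Γ z := by
  refine exists_raag_aut_update w _ (gen Γ v * gen Γ w * (gen Γ v)⁻¹)
    (fun a ha => ((gen_commute (hlk a ha)).inv_left.mul_left (gen_commute ha)).mul_left
      (gen_commute (hlk a ha)))
    (fun a ha => ((gen_commute (hlk a ha)).mul_left (gen_commute ha)).mul_left
      (gen_commute (hlk a ha)).inv_left) ?_ ?_ <;>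
  · intro F hw hz
    simp [hw, hz v hvw, mul_assoc]

/-- A vertex outside `st v` whose link lies in `st v` is a component of the complement. -/
theorem isCompOf_singleton {W : Type} {Γ : SimpleGraph W} {v w : W} (hw : w ∉ st Γ v)
    (hlk : Le Γ w v) : IsCompOf Γ (st Γ v)ᶜ {w} := by
  refine ⟨(Γ.induce (st Γ v)ᶜ).connectedComponentMk ⟨w, hw⟩, ?_⟩
  ext x
  simp only [Set.mem_singleton_iff, Set.mem_image, ConnectedComponent.mem_supp_iff,
    ConnectedComponent.eq]
  constructor
  · rintro rfl
    exact ⟨⟨x, hw⟩, Reachable.refl _, rfl⟩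
  · rintro ⟨y, hy, rfl⟩
    obtain ⟨p⟩ := hy.symm
    cases p with
    | nil => rfl
    | @cons _ u _ h _ => exact absurd (hlk h) u.2

/-- Membership in `IA_Γ(m)` may be checked on generators. -/
theorem mem_IAm_of_gen {W : Type} {Γ : SimpleGraph W} {m : ℕ} {α : MulAut (Raag Γ)}
    (h : ∀ z, Abelianization.of (α (gen Γ z)) * (Abelianization.of (gen Γ z))⁻¹ ∈ powN Γ m) :
    α ∈ IAm Γ m := by
  have key : ((QuotientGroup.mk' (powN Γ m)).comp Abelianization.of).comp α.toMonoidHom =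
      (QuotientGroup.mk' (powN Γ m)).comp Abelianization.of := by
    refine raag_hom_ext fun z => ?_
    refine QuotientGroup.eq.mpr ?_
    simpa [mul_comm] using inv_mem (h z)
  intro x
  obtain ⟨g, rfl⟩ : ∃ g, Abelianization.of g = x := QuotientGroup.mk_surjective x
  have hg := QuotientGroup.eq.mp (DFunLike.congr_fun key g)
  rw [← inv_mem_iff, mul_inv_rev, inv_inv, mul_comm]
  exact hg

/-- Powers of an automorphism right-multiplying one generator by another. -/
theorem transvection_pow_apply {W : Type} {Γ : SimpleGraph W} {v w : W} (hvw : v ≠ w)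
    {α : MulAut (Raag Γ)} (hv : α (gen Γ v) = gen Γ v * gen Γ w)
    (hz : ∀ z, z ≠ v → α (gen Γ z) = gen Γ z) (m : ℕ) :
    (α ^ m) (gen Γ v) = gen Γ v * gen Γ w ^ m := by
  induction m with
  | zero => simp
  | succ m ih => simp [pow_succ', MulAut.mul_apply, ih, hv, hz w hvw.symm, mul_assoc]

/-- Powers of an automorphism conjugating one generator by another. -/
theorem partialConj_pow_apply {W : Type} {Γ : SimpleGraph W} {v w : W} (hvw : v ≠ w)
    {α : MulAut (Raag Γ)} (hv : α (gen Γ v) = (gen Γ w)⁻¹ * gen Γ v * gen Γ w)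
    (hz : ∀ z, z ≠ v → α (gen Γ z) = gen Γ z) (m : ℕ) :
    (α ^ m) (gen Γ v) = (gen Γ w ^ m)⁻¹ * gen Γ v * gen Γ w ^ m := by
  induction m with
  | zero => simp
  | succ m ih =>
    rw [pow_succ' α, MulAut.mul_apply, ih]
    simp only [map_mul, map_inv, map_pow, hv, hz w hvw.symm]
    simp only [pow_succ', mul_inv_rev, mul_assoc]

/-- Powers of an automorphism fixing an element fix it. -/
theorem pow_apply_eq_self {W : Type} {Γ : SimpleGraph W} {α : MulAut (Raag Γ)} {x : Raag Γ}
    (h : α x = x) (m : ℕ) : (α ^ m) x = x := by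
  induction m with
  | zero => simp
  | succ m ih => rw [pow_succ, MulAut.mul_apply, h, ih]

theorem crossed_lantern (Γ : SimpleGraph V) (hB1 : B1 Γ)
    (v w : V) (hvw : v ≠ w) (hlk : v ∉ lk Γ w)
    (c₁ : MulAut (Raag Γ))
    (hc₁v : c₁ (gen Γ v) = (gen Γ w)⁻¹ * gen Γ v * gen Γ w)
    (hc₁z : ∀ z : V, z ≠ v → c₁ (gen Γ z) = gen Γ z) :
    ∃ t c₂ : MulAut (Raag Γ),
      (∀ m : ℕ, c₁ ^ m = (t ^ m)⁻¹ * c₂ * t ^ m * c₂⁻¹) ∧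
      (∀ m : ℕ, c₁ ^ m ∈ ⁅SIA Γ m, SIA Γ m⁆) := by
  have hnadj : ¬ Γ.Adj v w := fun h => hlk h.symm
  obtain ⟨hle, hle'⟩ := hB1 v w hvw hnadj
  have hvlk : ∀ a, Γ.Adj v a → Γ.Adj w a := fun a ha =>
    (hle ha).resolve_left fun h => hnadj (h ▸ ha)
  have hwlk : ∀ a, Γ.Adj w a → Γ.Adj v a := fun a ha =>
    (hle' ha).resolve_left fun h => hlk (h ▸ ha)
  obtain ⟨T, hTv, hTz⟩ := exists_transvection hvw hvlk
  obtain ⟨c, hcw, hcz⟩ := exists_partialConj hvw hwlk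
  have hTm := transvection_pow_apply hvw hTv hTz
  have hTmz : ∀ m : ℕ, ∀ z, z ≠ v → (T ^ m) (gen Γ z) = gen Γ z :=
    fun m z hz => pow_apply_eq_self (hTz z hz) m
  have hcm := partialConj_pow_apply hvw hc₁v hc₁z
  have hcmz : ∀ m : ℕ, ∀ z, z ≠ v → (c₁ ^ m) (gen Γ z) = gen Γ z :=
    fun m z hz => pow_apply_eq_self (hc₁z z hz) m
  have hcpow : ∀ m : ℕ, c (gen Γ w ^ m) = (gen Γ v)⁻¹ * gen Γ w ^ m * gen Γ v := fun m => by
    rw [map_pow, hcw]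
    simpa using conj_pow (a := (gen Γ v)⁻¹) (b := gen Γ w) (i := m)
  have hmain : ∀ m : ℕ, c₁ ^ m * c * T ^ m = T ^ m * c := fun m => by
    refine raag_aut_ext fun z => ?_
    simp only [MulAut.mul_apply]
    by_cases hz : z = v
    · subst hz
      rw [hTm, map_mul, hcpow, hcz z hvw, hTm]
      simp [hcm, hcmz m w hvw.symm, mul_assoc]
    by_cases hz' : z = w
    · subst hz'
      rw [hTmz m z hz, hcw]
      simp only [map_mul, map_inv, hcm, hcmz m z hz, hTm, hTmz m z hz]
      have hcomm : gen Γ z ^ m * gen Γ z * (gen Γ z ^ m)⁻¹ = gen Γ z := by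
        rw [← pow_succ, pow_succ', mul_inv_cancel_right]
      calc _ = (gen Γ z ^ m)⁻¹ * (gen Γ v)⁻¹ *
            (gen Γ z ^ m * gen Γ z * (gen Γ z ^ m)⁻¹) * gen Γ v * gen Γ z ^ m := by group
        _ = _ := by rw [hcomm]; group
    · rw [hTmz m z hz, hcz z hz', hcmz m z hz, hTmz m z hz]
  have hrel : ∀ m : ℕ, c₁ ^ m = T ^ m * c * (T ^ m)⁻¹ * c⁻¹ := fun m => by
    rw [← hmain m]
    group
  refine ⟨T⁻¹, c, fun m => by rw [hrel m, inv_pow, inv_inv], fun m => ?_⟩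
  have hT : T ^ m ∈ SIA Γ m := by
    refine ⟨(SAut0 Γ).pow_mem (Subgroup.subset_closure (Or.inl ⟨v, w, hvw, hle, hTv, hTz⟩)) m,
      mem_IAm_of_gen fun z => ?_⟩
    by_cases hz : z = v
    · subst hz
      refine ⟨Abelianization.of (gen Γ w), ?_⟩
      simp [hTm]
    · simp [hTmz m z hz, one_mem]
  have hc : c ∈ SIA Γ m := by
    refine ⟨Subgroup.subset_closure (Or.inr ⟨v, {w}, isCompOf_singleton ?_ hle', ?_, ?_⟩),
      mem_IAm_of_gen fun z => ?_⟩
    · rintro (h | h)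
      · exact hvw h.symm
      · exact hnadj h
    · rintro y rfl
      exact hcw
    · exact hcz
    · by_cases hz : z = w
      · subst hz
        simp [hcw, one_mem]
      · simp [hcz z hz, one_mem]
  rw [hrel m]
  exact Subgroup.commutator_mem_commutator hT hc

end RaagPaper
end
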